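/- arXiv:2104.06360 — 10 statements merged into one kernel-verified Lean document; each statement's English description precedes it below -/
import Mathlib

section
/- Let K ⊆ ℝⁿ be a closed convex set, let f : ℝⁿ → ℝⁿ be Lipschitz with constant L, and let T > 0. Suppose x, x̂ : [0,T] → ℝⁿ are continuous on [0,T], differentiable on (0,T), take values in K, and for every t ∈ (0,T) satisfy the variational inequalities ⟨x'(t) − f(x(t)), y − x(t)⟩ ≥ 0 and ⟨x̂'(t) − f(x̂(t)), y − x̂(t)⟩ ≥ 0 for all y ∈ K. Then for every t ∈ [0,T], ‖x(t) − x̂(t)‖ ≤ e^{Lt} ‖x(0) − x̂(0)‖. -/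
open Set
open scoped RealInnerProductSpace

/-- One-sided Grönwall estimate: if `⟪w t, w' t⟫ ≤ L * ‖w t‖ ^ 2`, then `‖w‖` grows at most
exponentially with rate `L`. -/
theorem norm_le_exp_mul_norm_of_inner_deriv_le {E : Type*} [NormedAddCommGroup E]
    [InnerProductSpace ℝ E] {w w' : ℝ → E} {L T : ℝ} (hc : ContinuousOn w (Icc 0 T))
    (hd : ∀ t ∈ Ioo (0 : ℝ) T, HasDerivAt w (w' t) t)
    (hle : ∀ t ∈ Ioo (0 : ℝ) T, ⟪w t, w' t⟫ ≤ L * ‖w t‖ ^ 2) {t : ℝ} (ht : t ∈ Icc (0 : ℝ) T) :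
    ‖w t‖ ≤ Real.exp (L * t) * ‖w 0‖ := by
  have hderiv : ∀ s ∈ Ioo (0 : ℝ) T, HasDerivAt (fun s => Real.exp (-(2 * L) * s) * ‖w s‖ ^ 2)
      (Real.exp (-(2 * L) * s) * (-(2 * L)) * ‖w s‖ ^ 2
        + Real.exp (-(2 * L) * s) * (2 * ⟪w s, w' s⟫)) s := fun s hs => by
    have h := ((hasDerivAt_id s).const_mul (-(2 * L))).exp.mul (hd s hs).norm_sq
    simp only [id, mul_one] at h
    exact h
  have hanti : AntitoneOn (fun s => Real.exp (-(2 * L) * s) * ‖w s‖ ^ 2) (Icc 0 T) := by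
    refine antitoneOn_of_deriv_nonpos (convex_Icc 0 T) (by fun_prop) ?_ ?_
    · rw [interior_Icc]
      exact fun s hs => (hderiv s hs).differentiableAt.differentiableWithinAt
    · rw [interior_Icc]
      intro s hs
      rw [(hderiv s hs).deriv]
      nlinarith [mul_le_mul_of_nonneg_left (hle s hs) (Real.exp_pos (-(2 * L) * s)).le]
  have h0 := hanti (left_mem_Icc.2 (ht.1.trans ht.2)) ht ht.1
  simp only [mul_zero, Real.exp_zero, one_mul] at h0
  have hexp : Real.exp (-(2 * L) * t) * Real.exp (L * t) ^ 2 = 1 := by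
    rw [← Real.exp_nat_mul, ← Real.exp_add, Real.exp_eq_one_iff]
    push_cast
    ring
  refine abs_le_of_sq_le_sq' ?_ (by positivity) |>.2
  calc ‖w t‖ ^ 2
      = Real.exp (L * t) ^ 2 * (Real.exp (-(2 * L) * t) * ‖w t‖ ^ 2) := by
        linear_combination (-‖w t‖ ^ 2) * hexp
    _ ≤ Real.exp (L * t) ^ 2 * ‖w 0‖ ^ 2 := by gcongr
    _ = (Real.exp (L * t) * ‖w 0‖) ^ 2 := by ring

/-- Continuity of solutions of the variational inequality
`ẋ ∈ f(x) − N_K(x)` with respect to initial conditions: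
`‖x(t) − x̂(t)‖ ≤ e^{Lt} ‖x(0) − x̂(0)‖`. -/
theorem stmt1 (n : ℕ) (K : Set (EuclideanSpace ℝ (Fin n)))
    (f : EuclideanSpace ℝ (Fin n) → EuclideanSpace ℝ (Fin n))
    (L T : ℝ) (hT : 0 < T)
    (hKclosed : IsClosed K) (hKconv : Convex ℝ K)
    (hfLip : ∀ a b, ‖f a - f b‖ ≤ L * ‖a - b‖)
    (x xh : ℝ → EuclideanSpace ℝ (Fin n))
    (x' xh' : ℝ → EuclideanSpace ℝ (Fin n))
    (hxc : ContinuousOn x (Icc 0 T)) (hxhc : ContinuousOn xh (Icc 0 T))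
    (hxK : ∀ t ∈ Icc (0 : ℝ) T, x t ∈ K) (hxhK : ∀ t ∈ Icc (0 : ℝ) T, xh t ∈ K)
    (hxd : ∀ t ∈ Ioo (0 : ℝ) T, HasDerivAt x (x' t) t)
    (hxhd : ∀ t ∈ Ioo (0 : ℝ) T, HasDerivAt xh (xh' t) t)
    (hVI : ∀ t ∈ Ioo (0 : ℝ) T, ∀ y ∈ K, 0 ≤ ⟪x' t - f (x t), y - x t⟫)
    (hVIh : ∀ t ∈ Ioo (0 : ℝ) T, ∀ y ∈ K, 0 ≤ ⟪xh' t - f (xh t), y - xh t⟫) :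
    ∀ t ∈ Icc (0 : ℝ) T, ‖x t - xh t‖ ≤ Real.exp (L * t) * ‖x 0 - xh 0‖ := by
  intro t ht
  refine norm_le_exp_mul_norm_of_inner_deriv_le (w := fun s => x s - xh s)
    (w' := fun s => x' s - xh' s) (hxc.sub hxhc) (fun s hs => (hxd s hs).sub (hxhd s hs)) ?_ ht
  intro s hs
  have hsI := Ioo_subset_Icc_self hs
  have h₁ := hVI s hs _ (hxhK s hsI)
  have h₂ := hVIh s hs _ (hxK s hsI)
  have hmono : ⟪x s - xh s, x' s - xh' s⟫ ≤ ⟪x s - xh s, f (x s) - f (xh s)⟫ := by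
    rw [real_inner_comm] at h₁ h₂
    simp only [inner_sub_left, inner_sub_right] at h₁ h₂ ⊢
    linarith
  calc ⟪x s - xh s, x' s - xh' s⟫ ≤ ⟪x s - xh s, f (x s) - f (xh s)⟫ := hmono
    _ ≤ ‖x s - xh s‖ * ‖f (x s) - f (xh s)‖ := real_inner_le_norm _ _
    _ ≤ ‖x s - xh s‖ * (L * ‖x s - xh s‖) := by gcongr; exact hfLip _ _
    _ = L * ‖x s - xh s‖ ^ 2 := by ring
end

section
/- Let f : ℝⁿ → ℝⁿ be Lipschitz with constant L and f(0)=0, let C_η ≥ 0 and T > 0. Suppose x : [0,T] → ℝⁿ is continuous on [0,T], differentiable on (0,T), and for every t ∈ (0,T) there is η(t) ∈ ℝⁿ with x'(t) = f(x(t)) + η(t) and ‖η(t)‖ ≤ C_η ‖f(x(t))‖. Then for every t ∈ [0,T], ‖x(t)‖ ≥ e^{−L(1+C_η)t} ‖x(0)‖. -/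
open Set

/-- If `‖x'‖ ≤ K ‖x‖` on the interior of an interval, then `‖x‖` decays at most exponentially. -/
theorem exp_neg_mul_norm_le_norm_of_norm_deriv_le {E : Type*} [NormedAddCommGroup E]
    [InnerProductSpace ℝ E] {x x' : ℝ → E} {K a b : ℝ}
    (hxc : ContinuousOn x (Icc a b)) (hxd : ∀ t ∈ Ioo a b, HasDerivAt x (x' t) t)
    (bound : ∀ t ∈ Ioo a b, ‖x' t‖ ≤ K * ‖x t‖) :
    ∀ t ∈ Icc a b, Real.exp (-K * (t - a)) * ‖x a‖ ≤ ‖x t‖ := by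
  have hderiv : ∀ t ∈ Ioo a b, HasDerivAt (fun s => Real.exp (2 * K * s) * ‖x s‖ ^ 2)
      (Real.exp (2 * K * t) * (2 * K) * ‖x t‖ ^ 2 +
        Real.exp (2 * K * t) * (2 * inner ℝ (x t) (x' t))) t := fun t ht => by
    have h := ((hasDerivAt_id t).const_mul (2 * K)).exp
    simp only [id, mul_one] at h
    exact h.mul (hxd t ht).norm_sq
  have hmono : MonotoneOn (fun s => Real.exp (2 * K * s) * ‖x s‖ ^ 2) (Icc a b) := by
    refine monotoneOn_of_deriv_nonneg (convex_Icc a b) ?_ ?_ ?_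
    · exact (Continuous.continuousOn (by fun_prop)).mul (hxc.norm.pow 2)
    · rw [interior_Icc]
      exact fun t ht => (hderiv t ht).differentiableAt.differentiableWithinAt
    · rw [interior_Icc]
      intro t ht
      rw [(hderiv t ht).deriv]
      have h₁ := (abs_le.1 (abs_real_inner_le_norm (x t) (x' t))).1
      have h₂ := mul_le_mul_of_nonneg_left (bound t ht) (norm_nonneg (x t))
      have h₃ : 0 ≤ K * ‖x t‖ ^ 2 + inner ℝ (x t) (x' t) := by linarith [h₁, h₂]
      have h₄ := mul_nonneg (Real.exp_pos (2 * K * t)).le h₃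
      linarith
  intro t ht
  have h := hmono (left_mem_Icc.2 (ht.1.trans ht.2)) ht ht.1
  have hsq (s : ℝ) : Real.exp (2 * K * s) * ‖x s‖ ^ 2 = (Real.exp (K * s) * ‖x s‖) ^ 2 := by
    rw [mul_pow, ← Real.exp_nat_mul]
    ring_nf
  simp only [hsq] at h
  have h' := (sq_le_sq₀ (by positivity) (by positivity)).1 h
  calc Real.exp (-K * (t - a)) * ‖x a‖
      = Real.exp (-(K * t)) * (Real.exp (K * a) * ‖x a‖) := by
        rw [← mul_assoc, ← Real.exp_add]
        ring_nf
    _ ≤ Real.exp (-(K * t)) * (Real.exp (K * t) * ‖x t‖) := by gcongr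
    _ = ‖x t‖ := by rw [← mul_assoc, ← Real.exp_add]; simp

/-- Lower exponential bound `‖x(t)‖ ≥ e^{−L(1+C_η)t} ‖x(0)‖` for
trajectories satisfying `x'(t) = f(x(t)) + η(t)` with `‖η(t)‖ ≤ C_η ‖f(x(t))‖`. -/
theorem stmt2 (n : ℕ)
    (f : EuclideanSpace ℝ (Fin n) → EuclideanSpace ℝ (Fin n))
    (L Cη T : ℝ)
    (hfLip : ∀ a b, ‖f a - f b‖ ≤ L * ‖a - b‖) (hf0 : f 0 = 0)
    (hCη : 0 ≤ Cη) (hT : 0 < T)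
    (x : ℝ → EuclideanSpace ℝ (Fin n))
    (hxc : ContinuousOn x (Icc 0 T))
    (hxd : ∀ t ∈ Ioo (0 : ℝ) T,
      ∃ η : EuclideanSpace ℝ (Fin n),
        HasDerivAt x (f (x t) + η) t ∧ ‖η‖ ≤ Cη * ‖f (x t)‖) :
    ∀ t ∈ Icc (0 : ℝ) T, Real.exp (-(L * (1 + Cη)) * t) * ‖x 0‖ ≤ ‖x t‖ := by
  choose! η hη hη_le using hxd
  intro t ht
  simpa using exp_neg_mul_norm_le_norm_of_norm_deriv_le (K := L * (1 + Cη)) hxc hη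
    (fun s hs => by
      have hf : ‖f (x s)‖ ≤ L * ‖x s‖ := by simpa [hf0] using hfLip (x s) 0
      calc ‖f (x s) + η s‖ ≤ ‖f (x s)‖ + Cη * ‖f (x s)‖ :=
            (norm_add_le _ _).trans (by gcongr; exact hη_le s hs)
        _ = (1 + Cη) * ‖f (x s)‖ := by ring
        _ ≤ (1 + Cη) * (L * ‖x s‖) := by gcongr
        _ = L * (1 + Cη) * ‖x s‖ := by ring) t ht
end

section
/- Let K ⊆ ℝⁿ be a closed convex cone, f : ℝⁿ → ℝⁿ Lipschitz with constant L, z ∈ K, C_η ≥ 0, and h > 0. Let η_z ∈ ℝⁿ satisfy ⟨η_z, y − z⟩ ≥ 0 for all y ∈ K and ‖η_z‖ ≤ C_η, and set F := f(z) + η_z and z̃(t) := z + tF. Suppose: z̃(t) ∈ K for all t ∈ [0,h]; x : [0,h] → K is continuous with x(0) = z, differentiable on (0,h), and satisfies the variational inequality ⟨x'(t) − f(x(t)), y − x(t)⟩ ≥ 0 for all y ∈ K and t ∈ (0,h); and x(t) − z̃(t) + t z̃(t) ∈ K for all t ∈ (0,h]. Then there exists a constant C > 0 such that ‖z̃(t)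 − x(t)‖² ≤ C t³ for all t ∈ [0,h]; in particular ‖z + tF − x(t)‖/t → 0 as t → 0⁺. -/
open Set
open scoped RealInnerProductSpace

/-- A Grönwall estimate for a function starting at zero with quadratic forcing. -/
theorem le_cube_of_deriv_le_mul_add_sq {φ φ' : ℝ → ℝ} {a b h : ℝ} (ha : 0 ≤ a) (hb : 0 ≤ b)
    (hφc : ContinuousOn φ (Icc 0 h)) (hφ0 : φ 0 = 0)
    (hφd : ∀ t ∈ Ioo 0 h, HasDerivAt φ (φ' t) t)
    (hφ' : ∀ t ∈ Ioo 0 h, φ' t ≤ a * φ t + b * t ^ 2) :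
    ∀ t ∈ Icc 0 h, φ t ≤ b / 3 * Real.exp (a * h) * t ^ 3 := by
  have hanti : AntitoneOn (fun t => Real.exp (-a * t) * φ t - b / 3 * t ^ 3) (Icc 0 h) := by
    refine antitoneOn_of_hasDerivWithinAt_nonpos (convex_Icc 0 h)
      (f' := fun t => Real.exp (-a * t) * (-a) * φ t + Real.exp (-a * t) * φ' t - b * t ^ 2)
      (by fun_prop) ?_ ?_
    · rw [interior_Icc]
      intro t ht
      have hexp : HasDerivAt (fun t => Real.exp (-a * t)) (Real.exp (-a * t) * (-a)) t := by
        simpa using ((hasDerivAt_id t).const_mul (-a)).exp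
      have hcube : HasDerivAt (fun t : ℝ => b / 3 * t ^ 3) (b * t ^ 2) t := by
        refine ((hasDerivAt_pow 3 t).const_mul (b / 3)).congr_deriv ?_
        norm_num
        ring
      exact ((hexp.mul (hφd t ht)).sub hcube).hasDerivWithinAt
    · rw [interior_Icc]
      intro t ht
      have hexp : Real.exp (-a * t) ≤ 1 :=
        Real.exp_le_one_iff.2 (by nlinarith [mul_nonneg ha ht.1.le])
      have hbound := mul_le_mul_of_nonneg_left (hφ' t ht) (Real.exp_pos (-a * t)).le
      have hforce := mul_le_mul_of_nonneg_right hexp (mul_nonneg hb (sq_nonneg t))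
      linarith
  intro t ht
  have hle := hanti (left_mem_Icc.2 (ht.1.trans ht.2)) ht ht.1
  simp only [hφ0, mul_zero, ne_eq, OfNat.ofNat_ne_zero, not_false_eq_true, zero_pow, sub_zero,
    sub_nonpos] at hle
  have hinv : Real.exp (a * t) * Real.exp (-a * t) = 1 := by
    rw [← Real.exp_add]
    simp
  have hcube : 0 ≤ b / 3 * t ^ 3 := mul_nonneg (by positivity) (pow_nonneg ht.1 3)
  calc
    φ t = Real.exp (a * t) * (Real.exp (-a * t) * φ t) := by rw [← mul_assoc, hinv, one_mul]
    _ ≤ Real.exp (a * t) * (b / 3 * t ^ 3) := by gcongr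
    _ ≤ Real.exp (a * h) * (b / 3 * t ^ 3) := by
      gcongr
      exact ht.2
    _ = b / 3 * Real.exp (a * h) * t ^ 3 := by ring

/-- A function whose square is bounded by a cubic is `o(t)` as `t → 0⁺`. -/
theorem tendsto_div_of_sq_le_cube {g : ℝ → ℝ} {C h : ℝ} (hh : 0 < h) (hg : ∀ t, 0 ≤ g t)
    (hgC : ∀ t ∈ Icc 0 h, g t ^ 2 ≤ C * t ^ 3) :
    Filter.Tendsto (fun t => g t / t) (nhdsWithin 0 (Ioi 0)) (nhds 0) := by
  have hsqrt : Filter.Tendsto (fun t => √(C * t)) (nhdsWithin 0 (Ioi 0)) (nhds 0) := by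
    have hcont : Continuous fun t => √(C * t) := by fun_prop
    simpa using (hcont.tendsto 0).mono_left nhdsWithin_le_nhds
  refine tendsto_of_tendsto_of_tendsto_of_le_of_le' tendsto_const_nhds hsqrt ?_ ?_
  · filter_upwards [self_mem_nhdsWithin] with t ht
    exact div_nonneg (hg t) (le_of_lt ht)
  · filter_upwards [Ioc_mem_nhdsGT hh] with t ht
    refine Real.le_sqrt_of_sq_le ?_
    rw [div_pow, div_le_iff₀ (pow_pos ht.1 2)]
    calc
      g t ^ 2 ≤ C * t ^ 3 := hgC t (Ioc_subset_Icc_self ht)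
      _ = C * t * t ^ 2 := by ring

/-- A vector in the negated normal cone of a cone `K` at `z` is orthogonal to `z` and lies in the
dual cone of `K`. -/
theorem inner_eq_zero_and_inner_nonneg_of_cone {E : Type*} [NormedAddCommGroup E]
    [InnerProductSpace ℝ E] {K : Set E} (hK : ∀ c : ℝ, 0 ≤ c → ∀ v ∈ K, c • v ∈ K) {z η : E}
    (hz : z ∈ K) (hη : ∀ y ∈ K, 0 ≤ ⟪η, y - z⟫) :
    ⟪η, z⟫ = 0 ∧ ∀ y ∈ K, 0 ≤ ⟪η, y⟫ := by
  have h0 := hη _ (hK 0 le_rfl z hz)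
  have h2 := hη _ (hK 2 zero_le_two z hz)
  simp only [inner_sub_right, real_inner_smul_right] at h0 h2
  have hηz : ⟪η, z⟫ = 0 := by linarith
  refine ⟨hηz, fun y hy => ?_⟩
  simpa [inner_sub_right, hηz] using hη y hy

/-- First-order estimate `‖z + tF − x(t)‖² ≤ C t³`, hence
`‖z + tF − x(t)‖/t → 0` as `t → 0⁺`, for the solution `x` of the
complementarity system starting at `z` and `F = f(z) + η_z`. -/
theorem stmt3 (n : ℕ) (K : Set (EuclideanSpace ℝ (Fin n)))
    (f : EuclideanSpace ℝ (Fin n) → EuclideanSpace ℝ (Fin n))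
    (L Cη h : ℝ) (z ηz : EuclideanSpace ℝ (Fin n))
    (hKclosed : IsClosed K) (hKconv : Convex ℝ K)
    (hKcone : ∀ c : ℝ, 0 ≤ c → ∀ v ∈ K, c • v ∈ K)
    (hfLip : ∀ a b, ‖f a - f b‖ ≤ L * ‖a - b‖)
    (hz : z ∈ K) (hCη : 0 ≤ Cη) (hh : 0 < h)
    (hηz : ∀ y ∈ K, 0 ≤ ⟪ηz, y - z⟫) (hηb : ‖ηz‖ ≤ Cη)
    (x x' : ℝ → EuclideanSpace ℝ (Fin n))
    (hzt : ∀ t ∈ Icc (0 : ℝ) h, z + t • (f z + ηz) ∈ K)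
    (hxc : ContinuousOn x (Icc 0 h)) (hx0 : x 0 = z)
    (hxK : ∀ t ∈ Icc (0 : ℝ) h, x t ∈ K)
    (hxd : ∀ t ∈ Ioo (0 : ℝ) h, HasDerivAt x (x' t) t)
    (hVI : ∀ t ∈ Ioo (0 : ℝ) h, ∀ y ∈ K, 0 ≤ ⟪x' t - f (x t), y - x t⟫)
    (hcomb : ∀ t ∈ Ioc (0 : ℝ) h,
      x t - (z + t • (f z + ηz)) + t • (z + t • (f z + ηz)) ∈ K) :
    (∃ C > (0 : ℝ), ∀ t ∈ Icc (0 : ℝ) h,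
      ‖z + t • (f z + ηz) - x t‖ ^ 2 ≤ C * t ^ 3) ∧
    Filter.Tendsto (fun t : ℝ => ‖z + t • (f z + ηz) - x t‖ / t)
      (nhdsWithin 0 (Ioi 0)) (nhds 0) := by
  set F := f z + ηz with hF
  set M := max L 0
  have hM : 0 ≤ M := le_max_right L 0
  obtain ⟨hηz0, hηK⟩ := inner_eq_zero_and_inner_nonneg_of_cone hKcone hz hηz
  have hderiv : ∀ t ∈ Ioo (0 : ℝ) h, HasDerivAt (fun t => ‖z + t • F - x t‖ ^ 2)
      (2 * ⟪z + t • F - x t, F - x' t⟫) t := by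
    intro t ht
    have hlin : HasDerivAt (fun t : ℝ => z + t • F) F t := by
      simpa using ((hasDerivAt_id t).smul_const F).const_add z
    exact (hlin.sub (hxd t ht)).norm_sq
  have hbound : ∀ t ∈ Ioo (0 : ℝ) h, 2 * ⟪z + t • F - x t, F - x' t⟫ ≤
      (2 * M + M * ‖F‖) * ‖z + t • F - x t‖ ^ 2 + (M * ‖F‖ + 2 * (‖ηz‖ * ‖F‖)) * t ^ 2 := by
    intro t ht
    have hvi := hVI t ht _ (hzt t (Ioo_subset_Icc_self ht))
    have hη := hηK _ (hcomb t (Ioo_subset_Ioc_self ht))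
    set e := z + t • F - x t with he
    have hηe : ⟪ηz, e⟫ ≤ t ^ 2 * (‖ηz‖ * ‖F‖) := by
      have hηF := mul_le_mul_of_nonneg_left (real_inner_le_norm ηz F) (sq_nonneg t)
      rw [he]
      simp only [inner_add_right, inner_sub_right, real_inner_smul_right, hηz0] at hη ⊢
      linarith
    have hxz : ‖f z - f (x t)‖ ≤ M * (‖e‖ + t * ‖F‖) := by
      have hdist : ‖z - x t‖ ≤ ‖e‖ + t * ‖F‖ := by
        calc
          ‖z - x t‖ = ‖e - t • F‖ := by
            congr 1
            rw [he]
            abel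
          _ ≤ ‖e‖ + ‖t • F‖ := norm_sub_le _ _
          _ = ‖e‖ + t * ‖F‖ := by rw [norm_smul, Real.norm_of_nonneg ht.1.le]
      calc
        ‖f z - f (x t)‖ ≤ L * ‖z - x t‖ := hfLip _ _
        _ ≤ M * ‖z - x t‖ := by
          gcongr
          exact le_max_left L 0
        _ ≤ M * (‖e‖ + t * ‖F‖) := by gcongr
    have hfe : ⟪f z - f (x t), e⟫ ≤ M * (‖e‖ + t * ‖F‖) * ‖e‖ :=
      (real_inner_le_norm _ _).trans (by gcongr)
    have hsplit : ⟪e, F - x' t⟫ = ⟪f z - f (x t), e⟫ + ⟪ηz, e⟫ - ⟪x' t - f (x t), e⟫ := by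
      rw [real_inner_comm, ← inner_add_left, ← inner_sub_left]
      congr 1
      rw [hF]
      abel
    have hyoung := mul_nonneg (mul_nonneg hM (norm_nonneg F)) (sq_nonneg (t - ‖e‖))
    linarith
  have hcube := le_cube_of_deriv_le_mul_add_sq (by positivity) (by positivity)
    (by fun_prop : ContinuousOn (fun t => ‖z + t • F - x t‖ ^ 2) (Icc 0 h))
    (by simp [hx0]) hderiv hbound
  set C := (M * ‖F‖ + 2 * (‖ηz‖ * ‖F‖)) / 3 * Real.exp ((2 * M + M * ‖F‖) * h)
  have hC : 0 ≤ C := by positivity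
  refine ⟨⟨C + 1, by positivity, fun t ht => (hcube t ht).trans ?_⟩,
    tendsto_div_of_sq_le_cube hh (fun t => norm_nonneg _) hcube⟩
  have ht3 := pow_nonneg ht.1 3
  gcongr
  exact le_add_of_nonneg_right zero_le_one
end

section
/- Let K ⊆ ℝⁿ be a closed convex cone, d ≥ 1 a real number, and φ : K × [0,∞) → K a map satisfying the scaling law φ(λz, t) = λ φ(z, λ^{d−1} t) for all λ > 0, z ∈ K, t ≥ 0. If the origin is locally exponentially stable, i.e. there exist r > 0, c₀ > 0 and α > 0 such that ‖φ(z,t)‖ ≤ c₀ e^{−αt} ‖z‖ for all t ≥ 0 whenever z ∈ K and ‖z‖ ≤ r, then the origin is globally exponentially stable: ‖φ(z,t)‖ ≤ c₀ e^{−αt} ‖z‖ for all z ∈ K and all t ≥ 0. -/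
open Set

/-- For a semiflow satisfying the scaling law
`φ(λz, t) = λ φ(z, λ^{d−1} t)`, local exponential stability of the origin
implies global exponential stability (with the same constants). -/
theorem stmt5 (n : ℕ) (K : Set (EuclideanSpace ℝ (Fin n)))
    (d : ℝ) (hd : 1 ≤ d)
    (hKclosed : IsClosed K) (hKconv : Convex ℝ K)
    (hKcone : ∀ c : ℝ, 0 ≤ c → ∀ x ∈ K, c • x ∈ K)
    (φ : EuclideanSpace ℝ (Fin n) → ℝ → EuclideanSpace ℝ (Fin n))
    (hφK : ∀ z ∈ K, ∀ t ≥ (0 : ℝ), φ z t ∈ K)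
    (hscale : ∀ l : ℝ, 0 < l → ∀ z ∈ K, ∀ t ≥ (0 : ℝ),
      φ (l • z) t = l • φ z (l ^ (d - 1) * t))
    (r c₀ α : ℝ) (hr : 0 < r) (hc₀ : 0 < c₀) (hα : 0 < α)
    (hloc : ∀ z ∈ K, ‖z‖ ≤ r → ∀ t ≥ (0 : ℝ),
      ‖φ z t‖ ≤ c₀ * Real.exp (-α * t) * ‖z‖) :
    ∀ z ∈ K, ∀ t ≥ (0 : ℝ), ‖φ z t‖ ≤ c₀ * Real.exp (-α * t) * ‖z‖ := by
  intro z hz t ht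
  rcases le_total ‖z‖ r with hzr | hzr
  · exact hloc z hz hzr t ht
  set l : ℝ := ‖z‖ / r with hl
  have hl1 : 1 ≤ l := (one_le_div hr).2 hzr
  have hl0 : 0 < l := one_pos.trans_le hl1
  have hp : 1 ≤ l ^ (d - 1) := Real.one_le_rpow hl1 (by linarith)
  have hw : l⁻¹ • z ∈ K := hKcone _ (inv_nonneg.2 hl0.le) z hz
  have hnorm : l * ‖l⁻¹ • z‖ = ‖z‖ := by
    rw [norm_smul, norm_inv, Real.norm_of_nonneg hl0.le, mul_inv_cancel_left₀ hl0.ne']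
  have hwr : ‖l⁻¹ • z‖ ≤ r := by
    refine le_of_mul_le_mul_left ?_ hl0
    rw [hnorm, hl, div_mul_cancel₀ _ hr.ne']
  have hst : t ≤ l ^ (d - 1) * t := le_mul_of_one_le_left ht hp
  have hscale_z := hscale l hl0 _ hw t ht
  rw [smul_inv_smul₀ hl0.ne'] at hscale_z
  calc ‖φ z t‖ = l * ‖φ (l⁻¹ • z) (l ^ (d - 1) * t)‖ := by
        rw [hscale_z, norm_smul, Real.norm_of_nonneg hl0.le]
    _ ≤ l * (c₀ * Real.exp (-α * (l ^ (d - 1) * t)) * ‖l⁻¹ • z‖) := by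
        gcongr
        exact hloc _ hw hwr _ (ht.trans hst)
    _ = c₀ * Real.exp (-α * (l ^ (d - 1) * t)) * ‖z‖ := by
        rw [mul_left_comm, hnorm]
    _ ≤ c₀ * Real.exp (-α * t) * ‖z‖ := by
        have hexp : -α * (l ^ (d - 1) * t) ≤ -α * t :=
          mul_le_mul_of_nonpos_left hst (neg_nonpos.2 hα.le)
        gcongr
end

section
/- Let W : ℝⁿ → ℝ be continuous with W(0) = 0, and suppose that for each x ≠ 0, W(λx) → ∞ as λ → ∞. Let a : ℝ → ℝ be continuous and nondecreasing with 0 ≤ a ≤ 1, a(s) = 0 for s ≤ 1, and a(s) = 1 for s ≥ 2, and let k be a positive integer. Then for every x ∈ ℝⁿ \ {0} the integral W̄(x) := ∫₀^∞ λ^{−(k+1)} a(W(λx)) dλ converges, and W̄ is positively homogeneous of degree k: W̄(sx) = sᵏ W̄(x) for all x ∈ ℝⁿ \ {0} and all s > 0. -/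
open Set MeasureTheory

/-- A continuous function with values in `[0, 1]` that vanishes near `0` on the right is integrable
on `(0, ∞)` against `l ^ (-(k + 1))` when `k` is positive. -/
theorem integrableOn_Ioi_div_pow {f : ℝ → ℝ} {k : ℕ} {ε : ℝ} (hk : 0 < k) (hf : Continuous f)
    (hf01 : ∀ l, 0 ≤ f l ∧ f l ≤ 1) (hε : 0 < ε) (hzero : ∀ l, 0 < l → l ≤ ε → f l = 0) :
    IntegrableOn (fun l : ℝ => f l / l ^ (k + 1)) (Ioi 0) := by
  rw [← Ioc_union_Ioi_eq_Ioi hε.le]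
  refine IntegrableOn.union ?_ ?_
  · exact integrableOn_zero.congr_fun (fun l hl => by simp [hzero l hl.1 hl.2]) measurableSet_Ioc
  · have hk' : (1 : ℝ) ≤ k := by exact_mod_cast hk
    have hint : IntegrableOn (fun l : ℝ => l ^ (-((k : ℝ) + 1))) (Ioi ε) :=
      integrableOn_Ioi_rpow_of_lt (by linarith) hε
    have hmeas : Measurable fun l : ℝ => f l / l ^ (k + 1) := by fun_prop
    refine Integrable.mono' hint hmeas.aestronglyMeasurable ?_
    refine ae_restrict_of_forall_mem measurableSet_Ioi fun l hl => ?_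
    have hl0 : 0 < l := hε.trans hl
    rw [Real.norm_of_nonneg (div_nonneg (hf01 l).1 (by positivity)), Real.rpow_neg hl0.le,
      ← Nat.cast_add_one, Real.rpow_natCast, ← one_div]
    exact div_le_div_of_nonneg_right (hf01 l).2 (by positivity)

/-- The integral `W̄(x) = ∫₀^∞ λ^{−(k+1)} a(W(λx)) dλ` converges for
every `x ≠ 0`, and `W̄` is positively homogeneous of degree `k`. -/
theorem stmt6 (n : ℕ) (W : EuclideanSpace ℝ (Fin n) → ℝ) (a : ℝ → ℝ) (k : ℕ)
    (hW : Continuous W) (hW0 : W 0 = 0)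
    (hWinf : ∀ x : EuclideanSpace ℝ (Fin n), x ≠ 0 →
      Filter.Tendsto (fun l : ℝ => W (l • x)) Filter.atTop Filter.atTop)
    (ha : Continuous a) (hamono : Monotone a)
    (ha01 : ∀ s, 0 ≤ a s ∧ a s ≤ 1)
    (ha0 : ∀ s ≤ (1 : ℝ), a s = 0) (ha1 : ∀ s ≥ (2 : ℝ), a s = 1)
    (hk : 0 < k) :
    (∀ x : EuclideanSpace ℝ (Fin n), x ≠ 0 →
      IntegrableOn (fun l : ℝ => a (W (l • x)) / l ^ (k + 1)) (Ioi 0)) ∧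
    (∀ x : EuclideanSpace ℝ (Fin n), x ≠ 0 → ∀ s : ℝ, 0 < s →
      (∫ l in Ioi (0 : ℝ), a (W (l • s • x)) / l ^ (k + 1)) =
        s ^ k * ∫ l in Ioi (0 : ℝ), a (W (l • x)) / l ^ (k + 1)) := by
  refine ⟨fun x _ => ?_, fun x _ s hs => ?_⟩
  · have hcont : Continuous fun l : ℝ => a (W (l • x)) := by fun_prop
    have hsmall : ∀ᶠ l : ℝ in nhds 0, W (l • x) < 1 := by
      have hc : Continuous fun l : ℝ => W (l • x) := by fun_prop
      exact hc.continuousAt.eventually_lt continuousAt_const (by simp [hW0])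
    obtain ⟨ε, hε, hball⟩ := Metric.eventually_nhds_iff.mp hsmall
    exact integrableOn_Ioi_div_pow hk hcont (fun l => ha01 _) (half_pos hε) fun l hl hle =>
      ha0 _ (hball (by rw [Real.dist_eq, sub_zero, abs_of_pos hl]; linarith)).le
  · have h := integral_comp_mul_right_Ioi
      (fun l : ℝ => a (W (l • x)) / l ^ (k + 1)) 0 hs
    rw [zero_mul, smul_eq_mul] at h
    have hscale : ∀ l : ℝ, a (W (l • s • x)) / l ^ (k + 1) =
        s ^ (k + 1) * (a (W ((l * s) • x)) / (l * s) ^ (k + 1)) := by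
      intro l
      rw [smul_smul, mul_pow, mul_comm (l ^ (k + 1)), ← div_div, div_right_comm,
        mul_div_cancel₀ _ (pow_ne_zero _ hs.ne')]
    simp_rw [hscale]
    rw [integral_const_mul, h, ← mul_assoc, pow_succ, mul_assoc (s ^ k),
      mul_inv_cancel₀ hs.ne', mul_one]
end

section
/- Let d ≥ 1 be an integer, let G : (ℝⁿ)ᵈ → ℝ be a d-multilinear map, and set g(x) := G(x,…,x). Suppose V₁,…,V_m are finite subsets of the standard simplex Δ^S = {x ∈ ℝ₊ⁿ : x₁ + ⋯ + xₙ = 1} such that Δ^S ⊆ ⋃_{k=1}^m conv(V_k), and suppose that for every k ∈ {1,…,m} and every choice of points q₁,…,q_d ∈ V_k one has G(q₁,…,q_d) ≥ 0. Then g(x) ≥ 0 for every x ∈ ℝ₊ⁿ, i.e. g is copositive. -/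
/-- A multilinear form that is nonnegative on all tuples of points of a finite set `s` is
nonnegative on the diagonal of `convexHull ℝ s`. -/
theorem MultilinearMap.nonneg_diag_of_mem_convexHull {ι E : Type*} [Fintype ι]
    [AddCommGroup E] [Module ℝ E] (G : MultilinearMap ℝ (fun _ : ι => E) ℝ) {s : Finset E}
    (hG : ∀ q : ι → E, (∀ i, q i ∈ s) → 0 ≤ G q) {x : E} (hx : x ∈ convexHull ℝ (s : Set E)) :
    0 ≤ G fun _ => x := by
  classical
  obtain ⟨w, hw, -, rfl⟩ := Finset.mem_convexHull'.1 hx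
  rw [G.map_sum_finset (fun _ y => w y • y) fun _ => s]
  refine Finset.sum_nonneg fun r hr => ?_
  rw [Fintype.mem_piFinset] at hr
  rw [G.map_smul_univ (fun i => w (r i)) r]
  exact mul_nonneg (Finset.prod_nonneg fun i _ => hw _ (hr i)) (hG r hr)

/-- If finite subsets `V₁,…,V_m` of the standard simplex are such
that their convex hulls cover the simplex and the `d`-multilinear form `G` is
nonnegative on all `d`-tuples of points of each `V_k`, then `g(x) = G(x,…,x)` is
copositive (nonnegative on the nonnegative orthant). -/
theorem stmt11 (n d m : ℕ) (hd : 1 ≤ d) (hm : 1 ≤ m)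
    (G : MultilinearMap ℝ (fun _ : Fin d => EuclideanSpace ℝ (Fin n)) ℝ)
    (V : Fin m → Finset (EuclideanSpace ℝ (Fin n)))
    (hVsimplex : ∀ k, ∀ q ∈ V k, (∀ j, 0 ≤ q j) ∧ (∑ j, q j) = 1)
    (hcover : {x : EuclideanSpace ℝ (Fin n) | (∀ j, 0 ≤ x j) ∧ (∑ j, x j) = 1} ⊆
      ⋃ k, convexHull ℝ (V k : Set (EuclideanSpace ℝ (Fin n))))
    (hGnn : ∀ k, ∀ q : Fin d → EuclideanSpace ℝ (Fin n),
      (∀ j, q j ∈ V k) → 0 ≤ G q) :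
    ∀ x : EuclideanSpace ℝ (Fin n), (∀ j, 0 ≤ x j) → 0 ≤ G (fun _ => x) := by
  intro x hx
  rcases (Finset.sum_nonneg fun j _ => hx j).eq_or_lt with h0 | hpos
  · have hx0 : x = 0 := by
      ext j
      exact (Finset.sum_eq_zero_iff_of_nonneg fun j _ => hx j).1 h0.symm j (Finset.mem_univ j)
    exact (G.map_coord_zero (⟨0, hd⟩ : Fin d) hx0).ge
  · set c := ∑ j, x j
    have hy : c⁻¹ • x ∈ ⋃ k, convexHull ℝ (V k : Set (EuclideanSpace ℝ (Fin n))) := by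
      refine hcover ⟨fun j => mul_nonneg (inv_nonneg.2 hpos.le) (hx j), ?_⟩
      simp only [PiLp.smul_apply, smul_eq_mul, ← Finset.mul_sum]
      exact inv_mul_cancel₀ hpos.ne'
    obtain ⟨k, hk⟩ := Set.mem_iUnion.1 hy
    have h := G.nonneg_diag_of_mem_convexHull (hGnn k) hk
    rw [G.map_smul_univ (fun _ => c⁻¹) fun _ => x] at h
    exact nonneg_of_mul_nonneg_right h (Finset.prod_pos fun _ _ => inv_pos.2 hpos)
end

section
/- Let h ∈ ℝ[x₁,…,xₙ] be a homogeneous polynomial of degree m ≥ 1 such that h(x) > 0 for every x ∈ ℝ₊ⁿ \ {0}. Then there exists a natural number d such that the polynomial (x₁² + ⋯ + xₙ²)ᵈ · h(x₁², x₂², …, xₙ²) is a sum of squares of polynomials in ℝ[x₁,…,xₙ]. -/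
open scoped Nat in
/-- The coefficients of `(∑ Xᵢ) ^ d * p`, for `p` homogeneous of degree `m`, expressed through
falling factorials of the exponents. -/
theorem MvPolynomial.prod_factorial_mul_coeff_sum_X_pow_mul {σ : Type*} [Fintype σ]
    {m : ℕ} {p : MvPolynomial σ ℝ} (hp : p.IsHomogeneous m) (d : ℕ) (β : σ →₀ ℕ)
    (hβ : β.degree = d + m) :
    (∏ i, ((β i)! : ℝ)) * coeff β ((∑ i, X i) ^ d * p) =
      d ! * ∑ α ∈ p.support, coeff α p * ∏ i, ((β i).descFactorial (α i) : ℝ) := by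
  conv_lhs => rw [p.as_sum, Finset.mul_sum, coeff_sum, Finset.mul_sum]
  rw [Finset.mul_sum]
  refine Finset.sum_congr rfl fun α hα => ?_
  rw [coeff_mul_monomial']
  split_ifs with hle
  · have hdeg : (β - α).degree = d := by
      have hα' : α.degree = m := by
        by_contra hne
        exact (mem_support_iff.1 hα) (hp.coeff_eq_zero hne)
      have := congrArg Finsupp.degree (tsub_add_cancel_of_le hle)
      rw [map_add] at this
      omega
    have hspec := Nat.multinomial_spec Finset.univ (β - α)
    rw [← Finsupp.degree_eq_sum, hdeg,
      ← Finsupp.multinomial_eq_of_support_subset (Finset.subset_univ _)] at hspec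
    rw [coeff_sum_X_pow_of_fintype, if_pos (by rwa [Finsupp.degree_apply] at hdeg)]
    have hfac : (∏ i, ((β i)! : ℝ)) =
        (∏ i, (((β - α) i)! : ℝ)) * ∏ i, ((β i).descFactorial (α i) : ℝ) := by
      rw [← Finset.prod_mul_distrib]
      refine Finset.prod_congr rfl fun i _ => ?_
      rw [← Nat.factorial_mul_descFactorial (hle i)]
      simp
    rw [hfac, ← hspec]
    push_cast
    ring
  · obtain ⟨i, hi⟩ : ∃ i, β i < α i := by
      simpa [Finsupp.le_def] using hle
    have hzero : ∏ i, ((β i).descFactorial (α i) : ℝ) = 0 :=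
      Finset.prod_eq_zero (Finset.mem_univ i)
        (by exact_mod_cast Nat.descFactorial_eq_zero_iff_lt.2 hi)
    simp [hzero]

/-- **Pólya's theorem**: a form positive on the nonnegative orthant minus the origin has
nonnegative coefficients after multiplication by a high power of the sum of the variables. -/
theorem MvPolynomial.exists_coeff_sum_X_pow_mul_nonneg {σ : Type*} [Fintype σ]
    {m : ℕ} (hm : 1 ≤ m) {p : MvPolynomial σ ℝ} (hp : p.IsHomogeneous m)
    (hpos : ∀ x : σ → ℝ, (∀ i, 0 ≤ x i) → x ≠ 0 → 0 < eval x p) :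
    ∃ d : ℕ, ∀ β, 0 ≤ coeff β ((∑ i, X i) ^ d * p) := by
  let H : ℝ → (σ → ℝ) → ℝ := fun t x =>
    ∑ α ∈ p.support, coeff α p * ∏ i, ∏ j ∈ Finset.range (α i), (x i - j * t)
  have hcont : Continuous fun z : ℝ × (σ → ℝ) => H z.1 z.2 := by fun_prop
  have hnhds : ∀ᶠ t in nhds (0 : ℝ), ∀ x ∈ stdSimplex ℝ σ, 0 < H t x := by
    refine (isCompact_stdSimplex ℝ σ).eventually_forall_of_forall_eventually fun x hx => ?_
    refine hcont.continuousAt.eventually_const_lt ?_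
    have hx0 : x ≠ 0 := by
      rintro rfl
      simpa using hx.2
    simpa [H, eval_eq'] using hpos x hx.1 hx0
  have hlim : Filter.Tendsto (fun d : ℕ => ((d + m : ℕ) : ℝ)⁻¹) Filter.atTop (nhds 0) :=
    tendsto_inv_atTop_nhds_zero_nat.comp (Filter.tendsto_add_atTop_nat m)
  obtain ⟨d, hd⟩ := (hlim.eventually hnhds).exists
  refine ⟨d, fun β => ?_⟩
  by_cases hβ : β.degree = d + m
  swap
  · have hX : (∑ i, X i : MvPolynomial σ ℝ).IsHomogeneous 1 :=
      IsHomogeneous.sum _ _ _ fun i _ => isHomogeneous_X ℝ i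
    rw [((hX.pow d).mul hp).coeff_eq_zero (by rwa [one_mul])]
  have hN : (0 : ℝ) < (d + m : ℕ) := by exact_mod_cast (by omega : 0 < d + m)
  have key := prod_factorial_mul_coeff_sum_X_pow_mul hp d β hβ
  have hmem : (fun i => (β i : ℝ) * ((d + m : ℕ) : ℝ)⁻¹) ∈ stdSimplex ℝ σ := by
    refine ⟨fun i => by positivity, ?_⟩
    rw [← Finset.sum_mul, ← Nat.cast_sum, ← Finsupp.degree_eq_sum, hβ, mul_inv_cancel₀ hN.ne']
  have hH := hd _ hmem
  have hscale : ∑ α ∈ p.support, coeff α p * ∏ i, ((β i).descFactorial (α i) : ℝ) =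
      ((d + m : ℕ) : ℝ) ^ m *
        H ((d + m : ℕ) : ℝ)⁻¹ fun i => (β i : ℝ) * ((d + m : ℕ) : ℝ)⁻¹ := by
    rw [Finset.mul_sum]
    refine Finset.sum_congr rfl fun α hα => ?_
    have hα' : α.degree = m := by
      by_contra hne
      exact (mem_support_iff.1 hα) (hp.coeff_eq_zero hne)
    rw [mul_left_comm]
    congr 1
    have hpow : ((d + m : ℕ) : ℝ) ^ m = ∏ i, ((d + m : ℕ) : ℝ) ^ α i := by
      rw [Finset.prod_pow_eq_pow_sum, ← Finsupp.degree_eq_sum, hα']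
    rw [hpow, ← Finset.prod_mul_distrib]
    refine Finset.prod_congr rfl fun i _ => ?_
    rw [← descPochhammer_eval_eq_descFactorial, descPochhammer_eval_eq_prod_range,
      Finset.pow_eq_prod_const, ← Finset.prod_mul_distrib]
    refine Finset.prod_congr rfl fun j _ => ?_
    field_simp
  rw [hscale] at key
  have hfac : (0 : ℝ) < ∏ i, ((β i).factorial : ℝ) :=
    Finset.prod_pos fun i _ => by positivity
  refine (pos_of_mul_pos_right (a := ∏ i, ((β i).factorial : ℝ)) ?_ hfac.le).le
  rw [key]
  positivity

/-- Squaring the variables of a polynomial with nonnegative coefficients gives a sum of squares. -/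
theorem MvPolynomial.exists_expand_two_eq_sum_sq {σ : Type*} {p : MvPolynomial σ ℝ}
    (hp : ∀ β, 0 ≤ coeff β p) :
    ∃ (N : ℕ) (q : Fin N → MvPolynomial σ ℝ), expand 2 p = ∑ k, q k ^ 2 := by
  let e := p.support.equivFin
  refine ⟨p.support.card, fun k => monomial (e.symm k).1 √(coeff (e.symm k).1 p), ?_⟩
  rw [e.symm.sum_comp fun α : p.support => monomial α.1 √(coeff α.1 p) ^ 2,
    Finset.sum_coe_sort p.support fun α => monomial α √(coeff α p) ^ 2]
  conv_lhs => rw [p.as_sum, map_sum]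
  refine Finset.sum_congr rfl fun α _ => ?_
  rw [monomial_pow, Real.sq_sqrt (hp α), expand_monomial]


/-- Pólya / Parrilo: If `h` is homogeneous of degree `m ≥ 1` and
strictly positive on `ℝ₊ⁿ \ {0}`, then for some `d` the polynomial
`(x₁² + ⋯ + xₙ²)ᵈ · h(x₁²,…,xₙ²)` is a sum of squares. -/
theorem stmt12 (n m : ℕ) (hm : 1 ≤ m) (h : MvPolynomial (Fin n) ℝ)
    (hhom : h.IsHomogeneous m)
    (hpos : ∀ x : Fin n → ℝ, (∀ i, 0 ≤ x i) → x ≠ 0 → 0 < MvPolynomial.eval x h) :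
    ∃ (d N : ℕ) (q : Fin N → MvPolynomial (Fin n) ℝ),
      (∑ i, MvPolynomial.X i ^ 2) ^ d *
        MvPolynomial.bind₁ (fun i => MvPolynomial.X i ^ 2) h = ∑ k, q k ^ 2 := by
  obtain ⟨d, hd⟩ := MvPolynomial.exists_coeff_sum_X_pow_mul_nonneg hm hhom hpos
  obtain ⟨N, q, hq⟩ := MvPolynomial.exists_expand_two_eq_sum_sq hd
  refine ⟨d, N, q, ?_⟩
  rw [← hq, map_mul, map_pow, map_sum]
  simp only [MvPolynomial.expand_X]
  rfl
end

section
/- Let K ⊆ ℝⁿ, let φ : K × [0,∞) → ℝⁿ be such that for each z ∈ K the map t ↦ φ(z,t) is continuous, and let c₀, α, C, p > 0 be constants such that e^{−Ct} ‖z‖ ≤ ‖φ(z,t)‖ ≤ c₀ e^{−αt} ‖z‖ for all z ∈ K and t ≥ 0. Define V(z) := ∫₀^∞ ‖φ(z,τ)‖ᵖ dτ. Then V(z) is finite for every z ∈ K and satisfies the two-sided bound (1/(pC)) ‖z‖ᵖ ≤ V(z) ≤ (c₀ᵖ/(pα)) ‖z‖ᵖ for all z ∈ K. -/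
open Set MeasureTheory

/-- The `p`-th power of a decaying exponential bound. -/
theorem rpow_mul_exp_neg_mul {a r c p t : ℝ} (ha : 0 ≤ a) (hr : 0 ≤ r) :
    (a * Real.exp (-c * t) * r) ^ p = a ^ p * r ^ p * Real.exp (-(p * c) * t) := by
  rw [Real.mul_rpow (by positivity) hr, Real.mul_rpow ha (Real.exp_pos _).le, ← Real.exp_mul,
    show -c * t * p = -(p * c) * t by ring]
  ring

theorem integral_Ioi_const_mul_exp_neg_mul (b : ℝ) {c : ℝ} (hc : 0 < c) :
    ∫ t in Ioi (0 : ℝ), b * Real.exp (-c * t) = b / c := by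
  rw [integral_const_mul, integral_exp_mul_Ioi (neg_lt_zero.mpr hc)]
  simp [div_eq_mul_inv]

theorem integrableOn_Ioi_const_mul_exp_neg_mul (b : ℝ) {c : ℝ} (hc : 0 < c) :
    IntegrableOn (fun t => b * Real.exp (-c * t)) (Ioi 0) :=
  (integrableOn_exp_mul_Ioi (neg_lt_zero.mpr hc) 0).const_mul b

/-- Two-sided bound for the Lyapunov integral
`V(z) = ∫₀^∞ ‖φ(z,τ)‖ᵖ dτ`: it is finite and
`(1/(pC)) ‖z‖ᵖ ≤ V(z) ≤ (c₀ᵖ/(pα)) ‖z‖ᵖ`. -/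
theorem stmt14 (n : ℕ) (K : Set (EuclideanSpace ℝ (Fin n)))
    (φ : EuclideanSpace ℝ (Fin n) → ℝ → EuclideanSpace ℝ (Fin n))
    (c₀ α C p : ℝ)
    (hc₀ : 0 < c₀) (hα : 0 < α) (hC : 0 < C) (hp : 0 < p)
    (hcont : ∀ z ∈ K, ContinuousOn (φ z) (Ici 0))
    (hlow : ∀ z ∈ K, ∀ t ≥ (0 : ℝ), Real.exp (-C * t) * ‖z‖ ≤ ‖φ z t‖)
    (hup : ∀ z ∈ K, ∀ t ≥ (0 : ℝ), ‖φ z t‖ ≤ c₀ * Real.exp (-α * t) * ‖z‖) :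
    ∀ z ∈ K,
      IntegrableOn (fun τ => ‖φ z τ‖ ^ p) (Ioi 0) ∧
      (1 / (p * C)) * ‖z‖ ^ p ≤ (∫ τ in Ioi (0 : ℝ), ‖φ z τ‖ ^ p) ∧
      (∫ τ in Ioi (0 : ℝ), ‖φ z τ‖ ^ p) ≤ (c₀ ^ p / (p * α)) * ‖z‖ ^ p := by
  intro z hz
  have hlow' : ∀ t ∈ Ioi (0 : ℝ), ‖z‖ ^ p * Real.exp (-(p * C) * t) ≤ ‖φ z t‖ ^ p := by
    intro t ht
    have h := Real.rpow_le_rpow (by positivity) (hlow z hz t (le_of_lt ht)) hp.le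
    rw [← one_mul (Real.exp _), rpow_mul_exp_neg_mul zero_le_one (norm_nonneg z)] at h
    simpa using h
  have hup' : ∀ t ∈ Ioi (0 : ℝ),
      ‖φ z t‖ ^ p ≤ c₀ ^ p * ‖z‖ ^ p * Real.exp (-(p * α) * t) := by
    intro t ht
    rw [← rpow_mul_exp_neg_mul hc₀.le (norm_nonneg z)]
    exact Real.rpow_le_rpow (norm_nonneg _) (hup z hz t (le_of_lt ht)) hp.le
  have hupInt := integrableOn_Ioi_const_mul_exp_neg_mul (c₀ ^ p * ‖z‖ ^ p) (mul_pos hp hα)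
  have hlowInt := integrableOn_Ioi_const_mul_exp_neg_mul (‖z‖ ^ p) (mul_pos hp hC)
  have hmeas : AEStronglyMeasurable (fun τ => ‖φ z τ‖ ^ p) (volume.restrict (Ioi 0)) :=
    (((hcont z hz).mono Ioi_subset_Ici_self).norm.rpow_const
      fun _ _ => Or.inr hp.le).aestronglyMeasurable measurableSet_Ioi
  have hint : IntegrableOn (fun τ => ‖φ z τ‖ ^ p) (Ioi 0) := by
    refine Integrable.mono' hupInt hmeas ?_
    filter_upwards [ae_restrict_mem measurableSet_Ioi] with t ht
    rw [Real.norm_of_nonneg (by positivity)]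
    exact hup' t ht
  refine ⟨hint, ?_, ?_⟩
  · have h := setIntegral_mono_on hlowInt hint measurableSet_Ioi hlow'
    rw [integral_Ioi_const_mul_exp_neg_mul _ (mul_pos hp hC)] at h
    rwa [one_div_mul_eq_div]
  · have h := setIntegral_mono_on hint hupInt measurableSet_Ioi hup'
    rw [integral_Ioi_const_mul_exp_neg_mul _ (mul_pos hp hα)] at h
    rwa [div_mul_eq_mul_div]
end

section
/- Let K ⊆ ℝⁿ, let L, α, c₀ > 0, and set p := 2L/α + 1. Let φ : K × [0,∞) → ℝⁿ be such that each trajectory t ↦ φ(z,t) is continuous, and suppose that for all z, ẑ ∈ K and t ≥ 0: ‖φ(z,t) − φ(ẑ,t)‖ ≤ e^{Lt} ‖z − ẑ‖ and ‖φ(z,t)‖ ≤ c₀ e^{−αt} ‖z‖. Define V(z) := ∫₀^∞ ‖φ(z,τ)‖ᵖ dτ. Then V is Lipschitz on bounded subsets of K: for every R > 0 there exists C_R > 0 such that |V(z) − V(ẑ)| ≤ C_R ‖z − ẑ‖ for all z, ẑ ∈ K with ‖z‖ ≤ R and ‖ẑ‖ ≤ R. -/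
open Set MeasureTheory

theorem abs_rpow_sub_rpow_le {q M x y : ℝ} (hq : 0 ≤ q) (hx : x ∈ Icc 0 M) (hy : y ∈ Icc 0 M) :
    |x ^ (q + 1) - y ^ (q + 1)| ≤ (q + 1) * M ^ q * |x - y| := by
  refine (convex_Icc 0 M).norm_image_sub_le_of_norm_hasDerivWithin_le
    (f := fun u : ℝ => u ^ (q + 1)) (f' := fun u => (q + 1) * u ^ q) (fun u _ => ?_)
    (fun u hu => ?_) hy hx
  · simpa using (Real.hasDerivAt_rpow_const (x := u) (p := q + 1)
      (Or.inr (by linarith))).hasDerivWithinAt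
  · have := Real.rpow_nonneg hu.1 q
    rw [Real.norm_of_nonneg (by positivity)]
    gcongr
    exacts [hu.1, hu.2]

theorem integrableOn_norm_rpow_of_exp_decay {E : Type*} [NormedAddCommGroup E] {f : ℝ → E}
    {α c p : ℝ} (hα : 0 < α) (hp : 0 < p) (hc : 0 ≤ c) (hf : ContinuousOn f (Ici 0))
    (hdecay : ∀ t ≥ (0 : ℝ), ‖f t‖ ≤ c * Real.exp (-α * t)) :
    IntegrableOn (fun t => ‖f t‖ ^ p) (Ioi 0) := by
  have hcont : ContinuousOn (fun t => ‖f t‖ ^ p) (Ioi 0) :=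
    (hf.mono Ioi_subset_Ici_self).norm.rpow_const fun _ _ => Or.inr hp.le
  refine ((exp_neg_integrableOn_Ioi 0 (mul_pos hα hp)).const_mul (c ^ p)).mono'
    (hcont.aestronglyMeasurable measurableSet_Ioi) ?_
  filter_upwards [ae_restrict_mem measurableSet_Ioi] with t ht
  rw [Real.norm_of_nonneg (by positivity)]
  calc ‖f t‖ ^ p ≤ (c * Real.exp (-α * t)) ^ p := by
        gcongr
        exact hdecay t (le_of_lt ht)
    _ = c ^ p * Real.exp (-(α * p) * t) := by
        rw [Real.mul_rpow hc (Real.exp_pos _).le, ← Real.exp_mul]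
        ring_nf

/-- With `p = 2L/α + 1`, the Lyapunov integral
`V(z) = ∫₀^∞ ‖φ(z,τ)‖ᵖ dτ` is Lipschitz on bounded subsets of `K`. -/
theorem stmt16 (n : ℕ) (K : Set (EuclideanSpace ℝ (Fin n)))
    (L α c₀ : ℝ) (hL : 0 < L) (hα : 0 < α) (hc₀ : 0 < c₀)
    (φ : EuclideanSpace ℝ (Fin n) → ℝ → EuclideanSpace ℝ (Fin n))
    (hcont : ∀ z ∈ K, ContinuousOn (φ z) (Ici 0))
    (hlip : ∀ z ∈ K, ∀ zh ∈ K, ∀ t ≥ (0 : ℝ),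
      ‖φ z t - φ zh t‖ ≤ Real.exp (L * t) * ‖z - zh‖)
    (hdecay : ∀ z ∈ K, ∀ t ≥ (0 : ℝ), ‖φ z t‖ ≤ c₀ * Real.exp (-α * t) * ‖z‖) :
    ∀ R > (0 : ℝ), ∃ CR > (0 : ℝ), ∀ z ∈ K, ∀ zh ∈ K, ‖z‖ ≤ R → ‖zh‖ ≤ R →
      |(∫ τ in Ioi (0 : ℝ), ‖φ z τ‖ ^ (2 * L / α + 1)) -
        ∫ τ in Ioi (0 : ℝ), ‖φ zh τ‖ ^ (2 * L / α + 1)| ≤ CR * ‖z - zh‖ := by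
  intro R hR
  set q := 2 * L / α with hq
  have hq0 : 0 < q := by positivity
  have hbound : ∀ z ∈ K, ‖z‖ ≤ R → ∀ t ≥ (0 : ℝ), ‖φ z t‖ ≤ c₀ * R * Real.exp (-α * t) := by
    intro z hz hzR t ht
    calc ‖φ z t‖ ≤ c₀ * Real.exp (-α * t) * ‖z‖ := hdecay z hz t ht
      _ ≤ c₀ * Real.exp (-α * t) * R := by gcongr
      _ = c₀ * R * Real.exp (-α * t) := by ring
  have hint : ∀ z ∈ K, ‖z‖ ≤ R → IntegrableOn (fun t => ‖φ z t‖ ^ (q + 1)) (Ioi 0) :=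
    fun z hz hzR => integrableOn_norm_rpow_of_exp_decay hα (by positivity) (by positivity)
      (hcont z hz) (hbound z hz hzR)
  refine ⟨(q + 1) * (c₀ * R) ^ q * (1 / L), by positivity, fun z hz zh hzh hzR hzhR => ?_⟩
  rw [← integral_sub (hint z hz hzR) (hint zh hzh hzhR), ← Real.norm_eq_abs]
  calc _ ≤ ∫ t in Ioi (0 : ℝ), (q + 1) * (c₀ * R) ^ q * ‖z - zh‖ * Real.exp (-L * t) := by
        refine norm_integral_le_of_norm_le ((exp_neg_integrableOn_Ioi 0 hL).const_mul _) ?_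
        filter_upwards [ae_restrict_mem measurableSet_Ioi] with t ht
        have ht0 : 0 ≤ t := le_of_lt ht
        have hexp : (c₀ * R * Real.exp (-α * t)) ^ q = (c₀ * R) ^ q * Real.exp (-(2 * L) * t) := by
          rw [Real.mul_rpow (by positivity) (Real.exp_pos _).le, ← Real.exp_mul, hq]
          congr 2
          field_simp
        calc ‖‖φ z t‖ ^ (q + 1) - ‖φ zh t‖ ^ (q + 1)‖
            ≤ (q + 1) * (c₀ * R * Real.exp (-α * t)) ^ q * |‖φ z t‖ - ‖φ zh t‖| :=
              abs_rpow_sub_rpow_le hq0.le ⟨norm_nonneg _, hbound z hz hzR t ht0⟩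
                ⟨norm_nonneg _, hbound zh hzh hzhR t ht0⟩
          _ ≤ (q + 1) * (c₀ * R * Real.exp (-α * t)) ^ q * (Real.exp (L * t) * ‖z - zh‖) := by
              gcongr
              exact (abs_norm_sub_norm_le _ _).trans (hlip z hz zh hzh t ht0)
          _ = (q + 1) * (c₀ * R) ^ q * ‖z - zh‖ *
                (Real.exp (-(2 * L) * t) * Real.exp (L * t)) := by rw [hexp]; ring
          _ = _ := by rw [← Real.exp_add]; ring_nf
    _ = (q + 1) * (c₀ * R) ^ q * (1 / L) * ‖z - zh‖ := by
        rw [integral_const_mul, integral_exp_mul_Ioi (neg_lt_zero.mpr hL)]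
        simp
        ring
end

section
/- Let K ⊆ ℝⁿ be a closed convex set, f : ℝⁿ → ℝⁿ, and β : ℝⁿ → ℝ continuous. Suppose z : [0,∞) → K is differentiable and satisfies, for all t ≥ 0, the variational inequality ⟨z'(t) − β(z(t)) f(z(t)), y − z(t)⟩ ≥ 0 for all y ∈ K, and suppose there is β₀ > 0 with β(z(s)) ≥ β₀ for all s ≥ 0. Define ρ(t) := ∫₀ᵗ β(z(s)) ds. Then ρ is a strictly increasing continuous bijection from [0,∞) onto [0,∞), and the reparametrized curve x := z ∘ ρ⁻¹ takes values in K, is differentiable on (0,∞), and satisfies ⟨x'(t) − f(x(t)), y − x(t)⟩ ≥ 0 for all y ∈ K and all t > 0. -/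
open Set
open scoped RealInnerProductSpace

/-- The primitive of a continuous function bounded below by a positive constant is an order
isomorphism of `ℝ`, whose inverse is differentiable with the reciprocal derivative. -/
theorem exists_orderIso_integral_of_continuous {g : ℝ → ℝ} (hg : Continuous g) {c : ℝ}
    (hc : 0 < c) (hcg : ∀ t, c ≤ g t) :
    ∃ e : ℝ ≃o ℝ, (∀ t, e t = ∫ s in (0 : ℝ)..t, g s) ∧
      ∀ t, HasDerivAt e.symm (g (e.symm t))⁻¹ t := by
  set R : ℝ → ℝ := fun t => ∫ s in (0 : ℝ)..t, g s
  have hR0 : R 0 = 0 := intervalIntegral.integral_same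
  have hRd : ∀ t, HasDerivAt R (g t) t := fun t => hg.integral_hasStrictDerivAt 0 t |>.hasDerivAt
  have hRdiff : Differentiable ℝ R := fun t => (hRd t).differentiableAt
  have hRmono : StrictMono R :=
    strictMono_of_deriv_pos fun t => by
      rw [(hRd t).deriv]
      exact hc.trans_le (hcg t)
  have hgrowth : ∀ ⦃s t⦄, s ≤ t → c * (t - s) ≤ R t - R s :=
    mul_sub_le_image_sub_of_le_deriv hRdiff fun t => by
      rw [(hRd t).deriv]
      exact hcg t
  have htop : Filter.Tendsto R Filter.atTop Filter.atTop := by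
    refine Filter.tendsto_atTop_mono' _ ?_ (Filter.tendsto_id.const_mul_atTop hc)
    filter_upwards [Filter.eventually_ge_atTop 0] with t ht
    simpa [hR0] using hgrowth ht
  have hbot : Filter.Tendsto R Filter.atBot Filter.atBot := by
    refine Filter.tendsto_atBot_mono' _ ?_ (Filter.tendsto_id.const_mul_atBot hc)
    filter_upwards [Filter.eventually_le_atBot 0] with t ht
    simpa [hR0] using hgrowth ht
  let e : ℝ ≃o ℝ := hRmono.orderIsoOfSurjective R (hRdiff.continuous.surjective htop hbot)
  refine ⟨e, fun t => rfl, fun t => ?_⟩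
  exact (hRd (e.symm t)).of_local_left_inverse e.symm.continuous.continuousAt
    (hc.trans_le (hcg _)).ne' (Filter.Eventually.of_forall e.apply_symm_apply)

/-- Time reparametrization of a solution of
`ż ∈ β(z) f(z) − N_K(z)` via `ρ(t) = ∫₀ᵗ β(z(s)) ds` yields a solution
`x = z ∘ ρ⁻¹` of `ẋ ∈ f(x) − N_K(x)`. -/
theorem stmt17 (n : ℕ) (K : Set (EuclideanSpace ℝ (Fin n)))
    (f : EuclideanSpace ℝ (Fin n) → EuclideanSpace ℝ (Fin n))
    (β : EuclideanSpace ℝ (Fin n) → ℝ) (β₀ : ℝ)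
    (hKclosed : IsClosed K) (hKconv : Convex ℝ K)
    (hβcont : Continuous β)
    (z z' : ℝ → EuclideanSpace ℝ (Fin n))
    (hzK : ∀ t ≥ (0 : ℝ), z t ∈ K)
    (hzd : ∀ t ≥ (0 : ℝ), HasDerivWithinAt z (z' t) (Ici 0) t)
    (hVI : ∀ t ≥ (0 : ℝ), ∀ y ∈ K, 0 ≤ ⟪z' t - β (z t) • f (z t), y - z t⟫)
    (hβ₀ : 0 < β₀) (hβb : ∀ s ≥ (0 : ℝ), β₀ ≤ β (z s)) :
    StrictMonoOn (fun t : ℝ => ∫ s in (0 : ℝ)..t, β (z s)) (Ici 0) ∧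
    ContinuousOn (fun t : ℝ => ∫ s in (0 : ℝ)..t, β (z s)) (Ici 0) ∧
    Set.BijOn (fun t : ℝ => ∫ s in (0 : ℝ)..t, β (z s)) (Ici 0) (Ici 0) ∧
    ∃ σ : ℝ → ℝ,
      (∀ t ≥ (0 : ℝ), σ t ∈ Ici (0 : ℝ) ∧
        (∫ s in (0 : ℝ)..(σ t), β (z s)) = t ∧
        σ (∫ s in (0 : ℝ)..t, β (z s)) = t) ∧
      (∀ t ≥ (0 : ℝ), z (σ t) ∈ K) ∧
      (∀ t > (0 : ℝ), ∃ v, HasDerivAt (fun u : ℝ => z (σ u)) v t ∧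
        ∀ y ∈ K, 0 ≤ ⟪v - f (z (σ t)), y - z (σ t)⟫) := by
  have hzc : Continuous fun s : ℝ => z (max s 0) :=
    ContinuousOn.comp_continuous (fun t ht => (hzd t ht).continuousWithinAt)
      (continuous_id.max continuous_const) fun s => le_max_right s 0
  obtain ⟨e, he, hed⟩ := exists_orderIso_integral_of_continuous (hβcont.comp hzc) hβ₀
    fun s => hβb _ (le_max_right s 0)
  have heq : ∀ t ∈ Ici (0 : ℝ), e t = ∫ s in (0 : ℝ)..t, β (z s) := fun t ht => by
    rw [he]
    refine intervalIntegral.integral_congr fun s hs => ?_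
    rw [uIcc_of_le ht] at hs
    simp [max_eq_left hs.1]
  have he0 : e 0 = 0 := by simp [he]
  have hs0 : e.symm 0 = 0 := by rw [e.symm_apply_eq, he0]
  have hsnn : ∀ t, 0 ≤ t → 0 ≤ e.symm t := fun t ht => hs0 ▸ e.symm.monotone ht
  have hbij : BijOn e (Ici 0) (Ici 0) :=
    ⟨fun t ht => he0 ▸ e.monotone ht, e.injective.injOn,
      fun t ht => ⟨e.symm t, hsnn t ht, e.apply_symm_apply t⟩⟩
  refine ⟨(e.strictMono.strictMonoOn _).congr heq,
    e.continuous.continuousOn.congr fun t ht => (heq t ht).symm, hbij.congr heq, e.symm,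
    fun t ht => ⟨hsnn t ht, ?_, ?_⟩, fun t ht => hzK _ (hsnn t ht), fun t ht => ?_⟩
  · rw [← heq _ (hsnn t ht), e.apply_symm_apply]
  · rw [← heq t ht, e.symm_apply_apply]
  have hpos : 0 < e.symm t := hs0 ▸ e.symm.strictMono ht
  have hd := hed t
  simp only [Function.comp_apply, max_eq_left hpos.le] at hd
  have hβpos : 0 < β (z (e.symm t)) := hβ₀.trans_le (hβb _ hpos.le)
  refine ⟨_, ((hzd _ hpos.le).hasDerivAt (Ici_mem_nhds hpos)).scomp t hd, fun y hy => ?_⟩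
  have hsmul : (β (z (e.symm t)))⁻¹ • z' (e.symm t) - f (z (e.symm t)) =
      (β (z (e.symm t)))⁻¹ • (z' (e.symm t) - β (z (e.symm t)) • f (z (e.symm t))) := by
    rw [smul_sub, inv_smul_smul₀ hβpos.ne']
  rw [hsmul, real_inner_smul_left]
  exact mul_nonneg (inv_nonneg.2 hβpos.le) (hVI _ hpos.le y hy)
end
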